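/- Let 0 ≤ a < 1 < b ≤ ∞ and f ∈ F₁(a,b) be strictly convex in a neighborhood of 1 with z₀ + β − α in the interior of {f* < ∞}, where z₀ := f'_+(1) and α ≤ β. Then for every n ∈ ℤ⁺: (β−α)/n ≤ inf_{z ∈ [z₀−(β−α), z₀]} { −z + ((n−1)/n) f*(z) + (1/n) f*(β−α+z) } ≤ (1/n)( f*(β−α+z₀) − z₀ ) ≤ (f*)'_+(β−α+z₀) · (β−α)/n. -/

import Mathlib

open MeasureTheory Set Filter Topology
open scoped ENNReal NNReal Classical

noncomputable section

/-- The interval `(a, b)` with `b` possibly infinite. -/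
def Dom (a : ℝ) (b : EReal) : Set ℝ := {t : ℝ | a < t ∧ (t : EReal) < b}

/-- Legendre transform of `f` on `(a,b)`, with values in `(-∞, ∞]` (modeled by `EReal`). -/
def fStar (f : ℝ → ℝ) (a : ℝ) (b : EReal) (z : ℝ) : EReal :=
  ⨆ t ∈ Dom a b, ((z * t - f t : ℝ) : EReal)

/-- Real-valued version of the Legendre transform (junk value where it is `⊤`). -/
def fStarR (f : ℝ → ℝ) (a : ℝ) (b : EReal) (z : ℝ) : ℝ := (fStar f a b z).toReal

/-- Right derivative of `g` at `z`. -/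
def rderiv (g : ℝ → ℝ) (z : ℝ) : ℝ := derivWithin g (Ici z) z

/-- `z₀ := f'_+(1)`. -/
def zz (f : ℝ → ℝ) : ℝ := rderiv f 1

/-- Integral of an `EReal`-valued function: the Bochner integral if the function is
a.e. finite and integrable, and `⊤` otherwise. -/
def eIntegral {X : Type*} [MeasurableSpace X] (P : Measure X) (g : X → EReal) : EReal :=
  if (∀ᵐ x ∂P, g x ≠ ⊤) ∧ Integrable (fun x => (g x).toReal) P
  then ((∫ x, (g x).toReal ∂P : ℝ) : EReal) else ⊤

/-- The generalized cumulant generating function `Λ_f^P[h]`. -/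
def cgf {X : Type*} [MeasurableSpace X] (f : ℝ → ℝ) (a : ℝ) (b : EReal)
    (P : Measure X) (h : X → ℝ) : EReal :=
  ⨅ ν : ℝ, ((ν : EReal) + eIntegral P (fun x => fStar f a b (h x - ν)))

/-- Real-valued `Λ_f^P[h]`. -/
def cgfR {X : Type*} [MeasurableSpace X] (f : ℝ → ℝ) (a : ℝ) (b : EReal)
    (P : Measure X) (h : X → ℝ) : ℝ := (cgf f a b P h).toReal

/-- `Λ_f : ℝⁿ → ℝ` (with values in `EReal`). -/
def lamVec (f : ℝ → ℝ) (a : ℝ) (b : EReal) {n : ℕ} (x : Fin n → ℝ) : EReal :=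
  ⨅ ν : ℝ, ((ν : EReal) + ((n : ℝ)⁻¹ : EReal) * ∑ i, fStar f a b (x i - ν))

/-- Empirical measure of `n` points. -/
def empMeas {X : Type*} [MeasurableSpace X] (n : ℕ) (xs : Fin n → X) : Measure X :=
  (n : ℝ≥0∞)⁻¹ • ∑ i, Measure.dirac (xs i)

/-- The `(f,Γ)`-divergence `D_f^Γ(Q‖P)`. -/
def Dfg {X : Type*} [MeasurableSpace X] (f : ℝ → ℝ) (a : ℝ) (b : EReal)
    (Γ : Set (X → ℝ)) (Q P : Measure X) : ℝ :=
  sSup {r : ℝ | ∃ h ∈ Γ, r = ∫ x, h x ∂Q - cgfR f a b P h}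

/-- Empirical Rademacher complexity of `Ψ` at the sample `y`. -/
def empRad {Y : Type*} (Ψ : Set (Y → ℝ)) (n : ℕ) (y : Fin n → Y) : ℝ :=
  (2 ^ n : ℝ)⁻¹ * ∑ σ : Fin n → Bool,
    sSup {r : ℝ | ∃ ψ ∈ Ψ, r = (n : ℝ)⁻¹ * ∑ i, (if σ i then 1 else -1) * ψ (y i)}

/-- Rademacher complexity of `Ψ` relative to `P` with `n` samples. -/
def rad {Y : Type*} [MeasurableSpace Y] (Ψ : Set (Y → ℝ)) (P : Measure Y) (n : ℕ) : ℝ :=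
  ∫ y, empRad Ψ n y ∂(Measure.pi fun _ : Fin n => P)

/-- `Δ_{f,n}`. -/
def Δq (f : ℝ → ℝ) (a : ℝ) (b : EReal) (α β : ℝ) (n : ℕ) : ℝ :=
  sInf ((fun z => (n : ℝ) * (-z + (((n : ℝ) - 1) / (n : ℝ)) * fStarR f a b z
      + (1 / (n : ℝ)) * fStarR f a b (β - α + z))) '' Icc (zz f - (β - α)) (zz f))

/-- `sup_{h ∈ Γ} inf_{h̃ ∈ Γ̃} ‖h − h̃‖_∞`. -/
def approxErr {X : Type*} (Γ Γt : Set (X → ℝ)) : ℝ :=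
  sSup {r : ℝ | ∃ h ∈ Γ, r = sInf {s : ℝ | ∃ ht ∈ Γt, s = ⨆ x, |h x - ht x|}}

/-- A countable subset which is pointwise-limit dense. -/
def PtwiseDenseCount {X : Type*} (Γ : Set (X → ℝ)) : Prop :=
  ∃ Γ₀ ⊆ Γ, Γ₀.Countable ∧ ∀ h ∈ Γ, ∃ s : ℕ → X → ℝ,
    (∀ j, s j ∈ Γ₀) ∧ ∀ x, Tendsto (fun j => s j x) atTop (𝓝 (h x))

/-- The quantity `K_{f,Ψ,P,n}` from Definition 3.4: either `(f*)'_+` is Lipschitz on the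
relevant interval and `Ψ` contains a constant, in which case `K` is the minimum of the two
expressions, or `K` is the second expression. -/
def Kchoice (f : ℝ → ℝ) (a : ℝ) (b : EReal) (α β : ℝ) {Y : Type*} [MeasurableSpace Y]
    (Ψ : Set (Y → ℝ)) (P : Measure Y) (n : ℕ) (K : ℝ) : Prop :=
  (∃ L : ℝ≥0, LipschitzOnWith L (rderiv (fStarR f a b))
      (Icc (zz f - (β - α)) (zz f + (β - α))) ∧
    (∃ c : ℝ, (fun _ => c) ∈ Ψ) ∧
    K = min ((1 + 2 * (β - α) * (L : ℝ)) * rad Ψ P n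
        + (β - α) ^ 2 * (L : ℝ) / (2 * Real.sqrt n))
      (rderiv (fStarR f a b) (β - α + zz f) * (rad Ψ P n + (β - α) / (2 * Real.sqrt n))))
  ∨ K = rderiv (fStarR f a b) (β - α + zz f) * (rad Ψ P n + (β - α) / (2 * Real.sqrt n))

/-- Covering number of a (pseudo)metric space by `ε`-balls. -/
def coverNum (Θ : Type*) [PseudoMetricSpace Θ] (ε : ℝ) : ℝ≥0∞ :=
  ⨅ s ∈ {s : Finset Θ | ∀ θ : Θ, ∃ c ∈ s, dist θ c ≤ ε}, ((s.card : ℝ≥0∞))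

end

section Legendre

variable {f : ℝ → ℝ} {a : ℝ} {b : EReal} {z w t c : ℝ}

lemma fStar_le_coe (h : ∀ t ∈ Dom a b, z * t - f t ≤ c) : fStar f a b z ≤ (c : EReal) :=
  iSup₂_le fun t ht => EReal.coe_le_coe_iff.2 (h t ht)

lemma fStar_lt_top (h : ∀ t ∈ Dom a b, z * t - f t ≤ c) : fStar f a b z < ⊤ :=
  (fStar_le_coe h).trans_lt (EReal.coe_lt_top c)

lemma coe_le_fStar (ht : t ∈ Dom a b) : ((z * t - f t : ℝ) : EReal) ≤ fStar f a b z :=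
  le_iSup₂ (f := fun (t : ℝ) (_ : t ∈ Dom a b) => ((z * t - f t : ℝ) : EReal)) t ht

lemma fStar_ne_bot (hD : (Dom a b).Nonempty) : fStar f a b z ≠ ⊥ :=
  let ⟨_, ht⟩ := hD
  ((EReal.bot_lt_coe _).trans_le (coe_le_fStar ht)).ne'

lemma le_fStarR (hfin : fStar f a b z < ⊤) (ht : t ∈ Dom a b) :
    z * t - f t ≤ fStarR f a b z := by
  rw [← EReal.coe_le_coe_iff, fStarR, EReal.coe_toReal hfin.ne (fStar_ne_bot ⟨t, ht⟩)]
  exact coe_le_fStar ht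

lemma fStarR_le (hD : (Dom a b).Nonempty) (h : ∀ t ∈ Dom a b, z * t - f t ≤ c) :
    fStarR f a b z ≤ c := by
  rw [← EReal.coe_le_coe_iff, fStarR, EReal.coe_toReal (fStar_lt_top h).ne (fStar_ne_bot hD)]
  exact fStar_le_coe h

/-- On a domain contained in `(0, ∞)`, the effective domain of `f*` is a lower set. -/
lemma fStar_lt_top_of_le (ha : 0 ≤ a) (hzw : z ≤ w) (hw : fStar f a b w < ⊤) :
    fStar f a b z < ⊤ :=
  fStar_lt_top (c := fStarR f a b w) fun t ht => by
    have := le_fStarR hw ht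
    nlinarith [ha.trans_lt ht.1]

lemma convexOn_fStarR (hD : (Dom a b).Nonempty) :
    ConvexOn ℝ {z : ℝ | fStar f a b z < ⊤} (fStarR f a b) := by
  have key : ∀ x, fStar f a b x < ⊤ → ∀ y, fStar f a b y < ⊤ → ∀ p q : ℝ, 0 ≤ p → 0 ≤ q →
      p + q = 1 → ∀ t ∈ Dom a b, (p * x + q * y) * t - f t ≤
        p * fStarR f a b x + q * fStarR f a b y := by
    intro x hx y hy p q hp hq hpq t ht
    have hft : f t = p * f t + q * f t := by rw [← add_mul, hpq, one_mul]
    have h₁ := mul_le_mul_of_nonneg_left (le_fStarR hx ht) hp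
    have h₂ := mul_le_mul_of_nonneg_left (le_fStarR hy ht) hq
    linarith
  exact ⟨fun x hx y hy p q hp hq hpq => fStar_lt_top (key x hx y hy p q hp hq hpq),
    fun x hx y hy p q hp hq hpq => fStarR_le hD (key x hx y hy p q hp hq hpq)⟩

end Legendre

/-- The subgradient inequality for the right derivative of a convex function. -/
lemma ConvexOn.rderiv_mul_sub_le {S : Set ℝ} {g : ℝ → ℝ} {x y : ℝ} (hg : ConvexOn ℝ S g)
    (hx : x ∈ interior S) (hy : y ∈ S) : rderiv g x * (y - x) ≤ g y - g x := by
  rw [rderiv, ← derivWithin_Ioi_eq_Ici]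
  rcases lt_trichotomy x y with h | rfl | h
  · have := hg.rightDeriv_le_slope_of_mem_interior hx hy h
    rwa [slope_def_field, le_div_iff₀ (sub_pos.2 h)] at this
  · simp
  · have := (hg.slope_le_leftDeriv_of_mem_interior hy hx h).trans
      (hg.leftDeriv_le_rightDeriv_of_mem_interior hx)
    rw [slope_def_field, div_le_iff₀ (sub_pos.2 h)] at this
    linarith

/-- `f*(z₀) = z₀`. -/
lemma fStarR_zz {f : ℝ → ℝ} {a : ℝ} {b : EReal} (hconv : ConvexOn ℝ (Dom a b) f)
    (h1 : 1 ∈ interior (Dom a b)) (hf1 : f 1 = 0) : fStarR f a b (zz f) = zz f := by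
  have key : ∀ t ∈ Dom a b, zz f * t - f t ≤ zz f := fun t ht => by
    have := hconv.rderiv_mul_sub_le h1 ht
    rw [← zz, hf1] at this
    linarith
  refine le_antisymm (fStarR_le ⟨1, interior_subset h1⟩ key) ?_
  have := le_fStarR (fStar_lt_top key) (interior_subset h1)
  rw [hf1] at this
  linarith

/-- Loose bounds on the single-coordinate perturbation quantity. -/
theorem stmt5 (f : ℝ → ℝ) (a : ℝ) (b : EReal) (α β : ℝ)
    (ha0 : 0 ≤ a) (ha1 : a < 1) (hb1 : ((1 : ℝ) : EReal) < b)
    (hconv : ConvexOn ℝ (Dom a b) f) (hf1 : f 1 = 0)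
    (hstrict : ∃ ε > 0, Set.Ioo (1 - ε) (1 + ε) ⊆ Dom a b ∧
      StrictConvexOn ℝ (Set.Ioo (1 - ε) (1 + ε)) f)
    (hz : zz f + β - α ∈ interior {z : ℝ | fStar f a b z < ⊤})
    (hαβ : α ≤ β) (n : ℕ) (hn : 0 < n) :
    (β - α) / (n : ℝ) ≤
        sInf ((fun z => -z + (((n : ℝ) - 1) / (n : ℝ)) * fStarR f a b z
            + (1 / (n : ℝ)) * fStarR f a b (β - α + z)) ''
          Set.Icc (zz f - (β - α)) (zz f)) ∧
      sInf ((fun z => -z + (((n : ℝ) - 1) / (n : ℝ)) * fStarR f a b z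
          + (1 / (n : ℝ)) * fStarR f a b (β - α + z)) ''
        Set.Icc (zz f - (β - α)) (zz f)) ≤
        (1 / (n : ℝ)) * (fStarR f a b (β - α + zz f) - zz f) ∧
      (1 / (n : ℝ)) * (fStarR f a b (β - α + zz f) - zz f) ≤
        rderiv (fStarR f a b) (β - α + zz f) * ((β - α) / (n : ℝ)) := by
  have hw : zz f + β - α = β - α + zz f := by ring
  rw [hw] at hz
  obtain ⟨ε, hε, hsub, -⟩ := hstrict
  have h1 : (1 : ℝ) ∈ interior (Dom a b) :=
    interior_maximal hsub isOpen_Ioo ⟨by linarith, by linarith⟩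
  have hD : (Dom a b).Nonempty := ⟨1, interior_subset h1⟩
  have hfin : ∀ z ≤ β - α + zz f, fStar f a b z < ⊤ := fun z hz' =>
    have hw : β - α + zz f ∈ {z : ℝ | fStar f a b z < ⊤} := interior_subset hz
    fStar_lt_top_of_le ha0 hz' hw
  have hle : ∀ z ≤ β - α + zz f, z ≤ fStarR f a b z := fun z hz' => by
    have := le_fStarR (hfin z hz') (interior_subset h1)
    rw [hf1] at this
    linarith
  have hz₀ := fStarR_zz hconv h1 hf1
  have hn0 : (0 : ℝ) < n := Nat.cast_pos.2 hn
  have hn1 : (1 : ℝ) ≤ n := Nat.one_le_cast.2 hn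
  have hlower : ∀ z ∈ Icc (zz f - (β - α)) (zz f), (β - α) / (n : ℝ) ≤
      -z + (((n : ℝ) - 1) / (n : ℝ)) * fStarR f a b z
        + (1 / (n : ℝ)) * fStarR f a b (β - α + z) := fun z hz' => by
    have h₁ := mul_le_mul_of_nonneg_left (hle z (by linarith [hz'.2]))
      (div_nonneg (sub_nonneg.2 hn1) hn0.le)
    have h₂ := mul_le_mul_of_nonneg_left (hle (β - α + z) (by linarith [hz'.2]))
      (one_div_nonneg.2 hn0.le)
    have h₃ : (β - α) / (n : ℝ) =
        -z + (((n : ℝ) - 1) / (n : ℝ)) * z + (1 / (n : ℝ)) * (β - α + z) := by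
      field_simp
      ring
    linarith
  have hmem : zz f ∈ Icc (zz f - (β - α)) (zz f) := ⟨by linarith, le_rfl⟩
  refine ⟨le_csInf (Set.Nonempty.image _ ⟨_, hmem⟩) (forall_mem_image.2 hlower), ?_, ?_⟩
  · refine csInf_le_of_le ⟨_, forall_mem_image.2 hlower⟩ (mem_image_of_mem _ hmem) (le_of_eq ?_)
    simp only [hz₀]
    field_simp
    ring
  · have := (convexOn_fStarR (f := f) hD).rderiv_mul_sub_le hz (hfin (zz f) (by linarith))
    rw [hz₀] at this
    rw [mul_div_assoc', one_div_mul_eq_div, div_le_div_iff_of_pos_right hn0]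
    linarith
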